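/- Let C₂ be the following collection of subsets of {1,...,11}: {1,2,3}, {1,4}, {1,5,7,8}, {1,6,9}, {1,10,11}, {2,4,5,6}, {2,7,11}, {2,8}, {2,9,10}, {3,4,9}, {3,5}, {3,6,8}, {3,7}, {3,10}, {3,11}, {4,7,10}, {4,8,11}, {5,9,11}, {5,10}, {6,7}, {6,10}, {6,11}, {7,9}, {8,9}, {8,10}. Then the only permutation τ of {1,...,11} such that the image under τ of every member of C₂ is again a member of C₂ is the identity. -/

import Mathlib

/- The combinatorics `C₂` of the 11-line arrangements of Appendix B.2 (lines indexed
by `Fin 11`, line `Lk` corresponding to `(k-1 : Fin 11)`). -/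
def C₂ : Finset (Finset (Fin 11)) :=
  {{0, 1, 2},
   {0, 3},
   {0, 4, 6, 7},
   {0, 5, 8},
   {0, 9, 10},
   {1, 3, 4, 5},
   {1, 6, 10},
   {1, 7},
   {1, 8, 9},
   {2, 3, 8},
   {2, 4},
   {2, 5, 7},
   {2, 6},
   {2, 9},
   {2, 10},
   {3, 6, 9},
   {3, 7, 10},
   {4, 8, 10},
   {4, 9},
   {5, 6},
   {5, 9},
   {5, 10},
   {6, 8},
   {7, 8},
   {7, 9}}

def edgeB (a b : Fin 11) : Bool :=
  match a.val, b.val with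
  | 0, 3 | 3, 0 | 1, 7 | 7, 1 | 2, 4 | 4, 2 | 2, 6 | 6, 2 | 2, 9 | 9, 2 | 2, 10 | 10, 2
  | 4, 9 | 9, 4 | 5, 6 | 6, 5 | 5, 9 | 9, 5 | 5, 10 | 10, 5 | 6, 8 | 8, 6
  | 7, 8 | 8, 7 | 7, 9 | 9, 7 => true
  | _, _ => false

set_option maxRecDepth 100000 in
theorem edge_of_mem : ∀ a b : Fin 11, ({a, b} : Finset (Fin 11)) ∈ C₂ → edgeB a b = true := by
  decide +kernel

set_option maxRecDepth 100000 in
set_option synthInstance.maxHeartbeats 2000000 in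
set_option synthInstance.maxSize 100000 in
theorem edge_search : ∀ a b : Fin 11, edgeB a b = true → ∀ c, edgeB a c = true → edgeB b c = true →
    ∀ d, edgeB a d = true → d ≠ b → d ≠ c → ∀ e, edgeB a e = true → e ≠ b → e ≠ c → e ≠ d →
    ∀ f, edgeB f d = true → edgeB f c = true → edgeB f e = true → f ≠ a → f ≠ b →
    ∀ g, edgeB d g = true → g ≠ a → g ≠ b → g ≠ c → g ≠ e → g ≠ f →
    ∀ k, edgeB k g = true → edgeB k c = true → k ≠ a → k ≠ b → k ≠ d → k ≠ e → k ≠ f →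
    ∀ l, edgeB l k = true → l ≠ c → l ≠ g →
    a = 2 ∧ b = 4 ∧ c = 9 ∧ d = 6 ∧ e = 10 ∧ f = 5 ∧ g = 8 ∧ k = 7 ∧ l = 1 := by
  decide +kernel

set_option maxRecDepth 100000 in
theorem last_mem : ∀ a : Fin 11, ({a, 1, 2} : Finset (Fin 11)) ∈ C₂ → a = 0 := by
  decide +kernel

theorem last_edge : ∀ a : Fin 11, edgeB 0 a = true → a = 3 := by
  decide +kernel

/-- The only permutation preserving the combinatorics `C₂` is the identity. -/
theorem statement17 (τ : Equiv.Perm (Fin 11)) (h : ∀ s ∈ C₂, s.image τ ∈ C₂) :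
    τ = 1 := by
  have he : ∀ a b : Fin 11, ({a, b} : Finset (Fin 11)) ∈ C₂ → edgeB (τ a) (τ b) = true := by
    intro a b hab
    apply edge_of_mem
    simpa [Finset.image_insert] using h _ hab
  have hn : ∀ a b : Fin 11, a ≠ b → τ a ≠ τ b := fun a b hab => τ.injective.ne hab
  obtain ⟨h2, h4, h9, h6, h10, h5, h8, h7, h1⟩ :=
    edge_search (τ 2) (τ 4) (he _ _ (by decide +kernel))
      (τ 9) (he _ _ (by decide +kernel)) (he _ _ (by decide +kernel))
      (τ 6) (he _ _ (by decide +kernel)) (hn _ _ (by decide)) (hn _ _ (by decide))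
      (τ 10) (he _ _ (by decide +kernel)) (hn _ _ (by decide)) (hn _ _ (by decide))
      (hn _ _ (by decide))
      (τ 5) (he _ _ (by decide +kernel)) (he _ _ (by decide +kernel)) (he _ _ (by decide +kernel))
      (hn _ _ (by decide)) (hn _ _ (by decide))
      (τ 8) (he _ _ (by decide +kernel)) (hn _ _ (by decide)) (hn _ _ (by decide))
      (hn _ _ (by decide)) (hn _ _ (by decide)) (hn _ _ (by decide))
      (τ 7) (he _ _ (by decide +kernel)) (he _ _ (by decide +kernel)) (hn _ _ (by decide))
      (hn _ _ (by decide)) (hn _ _ (by decide)) (hn _ _ (by decide)) (hn _ _ (by decide))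
      (τ 1) (he _ _ (by decide +kernel)) (hn _ _ (by decide)) (hn _ _ (by decide))
  have h0 : τ 0 = 0 := by
    apply last_mem
    have := h {0, 1, 2} (by decide +kernel)
    simpa [Finset.image_insert, h1, h2] using this
  have h3 : τ 3 = 3 := by
    apply last_edge
    have := he 0 3 (by decide +kernel)
    rwa [h0] at this
  ext x
  fin_cases x <;> simp [*]
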